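/- arXiv:1204.6566 — 2 statements merged into one kernel-verified Lean document; each statement's English description precedes it below -/
import Mathlib

section
/- Let G be a nilpotent group and H a finite proper normal subgroup of G. Then there is a nontrivial group homomorphism from the abelianization (G/H)_ab of the quotient G/H to G. -/
open scoped commutatorElement

theorem Module.exists_addMonoidHom_apply_eq_one (K : Type*) {V : Type*} [Field K]
    [AddCommGroup V] [Module K V] {v : V} (hv : v ≠ 0) : ∃ φ : V →+ K, φ v = 1 := by
  obtain ⟨φ, hφ⟩ : ∃ φ : Module.Dual K V, φ v ≠ 0 := by
    by_contra! h0
    exact hv ((Module.forall_dual_apply_eq_zero_iff K v).1 h0)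
  exact ⟨((φ v)⁻¹ • φ).toAddMonoidHom, inv_mul_cancel₀ hφ⟩

theorem exists_addMonoidHom_zmod_apply_eq_one {V : Type*} [AddCommGroup V] {p : ℕ}
    [Fact p.Prime] (hV : ∀ x : V, p • x = 0) {v : V} (hv : v ≠ 0) :
    ∃ φ : V →+ ZMod p, φ v = 1 :=
  @Module.exists_addMonoidHom_apply_eq_one (ZMod p) V _ _ (AddCommGroup.zmodModule hV) v hv

/-- If `g` has order `p`, then a commutative group with no nontrivial homomorphism to the group
containing `g` is `p`-divisible. -/
theorem exists_pow_eq_of_forall_hom_eq_one {A G : Type*} [CommGroup A] [Group G] {p : ℕ}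
    (hp : p.Prime) {g : G} (hg : orderOf g = p) (h : ∀ f : A →* G, f = 1) (a : A) :
    ∃ b : A, b ^ p = a := by
  have : Fact p.Prime := ⟨hp⟩
  by_contra! hcon
  let N : AddSubgroup (Additive A) := (nsmulAddMonoidHom (α := Additive A) p).range
  let V := Additive A ⧸ N
  have hV : ∀ x : V, p • x = 0 := by
    intro x
    induction x using QuotientAddGroup.induction_on with
    | H z => exact (QuotientAddGroup.eq_zero_iff (N := N) (p • z)).2 ⟨z, rfl⟩
  let v : V := QuotientAddGroup.mk' N (Additive.ofMul a)
  have hv : v ≠ 0 := by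
    intro h0
    obtain ⟨b, hb⟩ := (QuotientAddGroup.eq_zero_iff (N := N) (Additive.ofMul a)).1 h0
    exact hcon b.toMul (congrArg Additive.toMul hb)
  obtain ⟨φ, hφ⟩ := exists_addMonoidHom_zmod_apply_eq_one hV hv
  let l : ZMod p →+ Additive G := ZMod.lift p ⟨zmultiplesHom (Additive G) (Additive.ofMul g), by
    rw [zmultiplesHom_apply, natCast_zsmul, ← ofMul_pow, ← hg, pow_orderOf_eq_one, ofMul_one]⟩
  have hl : l 1 = Additive.ofMul g := by
    have := ZMod.lift_coe p (A := Additive G)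
      ⟨zmultiplesHom (Additive G) (Additive.ofMul g), by
        rw [zmultiplesHom_apply, natCast_zsmul, ← ofMul_pow, ← hg, pow_orderOf_eq_one,
          ofMul_one]⟩ 1
    simpa [l] using this
  let F : Additive A →+ Additive G := l.comp (φ.comp (QuotientAddGroup.mk' N))
  have hF : F (Additive.ofMul a) = Additive.ofMul g := by
    have : F (Additive.ofMul a) = l (φ v) := rfl
    rw [this, hφ, hl]
  have h1 : g = 1 := by
    have := DFunLike.congr_fun (h (MonoidHom.toAdditive.symm F)) a
    exact (congrArg Additive.toMul hF).symm.trans this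
  rw [h1, orderOf_one] at hg
  exact hp.one_lt.ne hg

theorem exists_pow_eq_of_forall_prime {A : Type*} [CommGroup A] {n : ℕ} (hn : n ≠ 0)
    (h : ∀ p : ℕ, p.Prime → p ∣ n → ∀ a : A, ∃ b, b ^ p = a) (a : A) : ∃ b, b ^ n = a := by
  induction n using induction_on_primes generalizing a with
  | zero => exact absurd rfl hn
  | one => exact ⟨a, pow_one a⟩
  | prime_mul p m hp ih =>
    obtain ⟨b, rfl⟩ := h p hp (dvd_mul_right p m) a
    obtain ⟨c, rfl⟩ := ih (right_ne_zero_of_mul hn)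
      (fun q hq hqm => h q hq (hqm.mul_left p)) b
    exact ⟨c, by rw [mul_comm, pow_mul]⟩

theorem commutatorElement_pow_left_of_commute {G : Type*} [Group G] {x g : G}
    (h : Commute x ⁅x, g⁆) (n : ℕ) : ⁅x ^ n, g⁆ = ⁅x, g⁆ ^ n := by
  have h1 : g * x⁻¹ * g⁻¹ = x⁻¹ * ⁅x, g⁆ := by rw [commutatorElement_def]; group
  have h2 : g * (x ^ n)⁻¹ * g⁻¹ = (x ^ n)⁻¹ * ⁅x, g⁆ ^ n := by
    rw [← inv_pow, ← conj_pow, h1, h.inv_left.mul_pow]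
  calc ⁅x ^ n, g⁆ = x ^ n * (g * (x ^ n)⁻¹ * g⁻¹) := by rw [commutatorElement_def]; group
    _ = ⁅x, g⁆ ^ n := by rw [h2, mul_inv_cancel_left]

/-- If `Z₂ / Z₁` has exponent dividing `n`, so do all `Zᵢ₊₂ / Zᵢ₊₁`. -/
theorem Subgroup.pow_mem_upperCentralSeries {G : Type*} [Group G] {n : ℕ}
    (h : ∀ x ∈ upperCentralSeries G 2, x ^ n ∈ upperCentralSeries G 1) (i : ℕ) :
    ∀ x ∈ upperCentralSeries G (i + 2), x ^ n ∈ upperCentralSeries G (i + 1) := by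
  induction i with
  | zero => exact h
  | succ i ih =>
    intro x hx
    rw [mem_upperCentralSeries_succ_iff] at hx ⊢
    intro g
    have hc := hx g
    let π := QuotientGroup.mk' (upperCentralSeries G (i + 1))
    have hcomm : Commute (π x) ⁅π x, π g⁆ := by
      rw [← map_commutatorElement, Commute, SemiconjBy, ← commutatorElement_eq_one_iff_mul_comm,
        ← map_commutatorElement]
      rw [← commutatorElement_inv, map_inv, inv_eq_one]
      exact (QuotientGroup.eq_one_iff _).2 (mem_upperCentralSeries_succ_iff.1 hc x)
    have h1 := commutatorElement_pow_left_of_commute hcomm n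
    rw [← map_pow, ← map_commutatorElement, ← map_commutatorElement, ← map_pow,
      show π (⁅x, g⁆ ^ n) = 1 from (QuotientGroup.eq_one_iff _).2 (ih _ hc)] at h1
    exact (QuotientGroup.eq_one_iff _).1 h1

theorem Subgroup.pow_pow_mem_upperCentralSeries_one {G : Type*} [Group G] {n : ℕ}
    (h : ∀ x ∈ upperCentralSeries G 2, x ^ n ∈ upperCentralSeries G 1) (i : ℕ) :
    ∀ x ∈ upperCentralSeries G (i + 1), x ^ n ^ i ∈ upperCentralSeries G 1 := by
  induction i with
  | zero => simp
  | succ i ih =>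
    intro x hx
    rw [pow_succ', pow_mul]
    exact ih _ (pow_mem_upperCentralSeries h i x hx)

/-- The commutator map `g ↦ ⁅x, g⁆` into the center, for `x` in the second center. -/
def Subgroup.commutatorHom {G : Type*} [Group G] (x : G) (hx : x ∈ upperCentralSeries G 2) :
    G →* center G :=
  MonoidHom.mk' (fun g => ⟨⁅x, g⁆, by
    rw [← upperCentralSeries_one]; exact mem_upperCentralSeries_succ_iff.1 hx g⟩) (by
    intro g k
    have hk : ⁅x, k⁆ ∈ center G := by
      rw [← upperCentralSeries_one]; exact mem_upperCentralSeries_succ_iff.1 hx k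
    refine Subtype.ext ?_
    calc ⁅x, g * k⁆ = ⁅x, g⁆ * (g * ⁅x, k⁆ * g⁻¹) := by
          simp only [commutatorElement_def]; group
      _ = ⁅x, g⁆ * ⁅x, k⁆ := by
          rw [mem_center_iff.1 hk g, mul_inv_cancel_right])

theorem Abelianization.nontrivial_of_isNilpotent (Q : Type*) [Group Q] [Group.IsNilpotent Q]
    [Nontrivial Q] : Nontrivial (Abelianization Q) :=
  QuotientGroup.nontrivial_iff.2 (Group.IsSolvable.commutator_lt_top_of_nontrivial Q).ne

theorem Abelianization.eq_one_of_forall_hom_eq_one {Q G : Type*} [Group Q] [Group G]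
    (h : ∀ f : Abelianization Q →* G, f = 1) (f : Q →* Subgroup.center G) (q : Q) : f q = 1 := by
  have hker : commutator Q ≤ ((Subgroup.center G).subtype.comp f).ker := by
    rw [commutator_def, Subgroup.commutator_le]
    intro a _ b _
    rw [MonoidHom.mem_ker, map_commutatorElement, commutatorElement_eq_one_iff_mul_comm]
    exact Subgroup.mem_center_iff.1 (f b).2 (f a)
  exact Subtype.ext (DFunLike.congr_fun (h (QuotientGroup.lift _ _ hker)) (Abelianization.of q))

/-- Let `G` be a nilpotent group and `H` a finite proper normal
subgroup of `G`. Then there is a nontrivial homomorphism from the abelianization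
`(G/H)_ab` to `G`. -/
theorem stmt9 {G : Type*} [Group G] [Group.IsNilpotent G]
    (H : Subgroup G) [H.Normal] (hfin : Finite H) (hproper : H ≠ ⊤) :
    ∃ f : Abelianization (G ⧸ H) →* G, f ≠ 1 := by
  by_contra! htriv
  let n := Nat.card H
  have hn : n ≠ 0 := Nat.card_pos.ne'
  have hdiv : ∀ a : Abelianization (G ⧸ H), ∃ b, b ^ n = a :=
    exists_pow_eq_of_forall_prime hn fun p hp hpn => by
      have : Fact p.Prime := ⟨hp⟩
      obtain ⟨g, hg⟩ := exists_prime_orderOf_dvd_card' p hpn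
      exact exists_pow_eq_of_forall_hom_eq_one hp ((Subgroup.orderOf_coe g).trans hg) htriv
  have hdiv_pow : ∀ i : ℕ, ∀ a : Abelianization (G ⧸ H), ∃ b, b ^ n ^ i = a := by
    intro i
    induction i with
    | zero => simp
    | succ i ih =>
      intro a
      obtain ⟨b, rfl⟩ := hdiv a
      obtain ⟨c, rfl⟩ := ih b
      exact ⟨c, by rw [pow_succ, pow_mul]⟩
  have hH : ∀ x ∈ H, x ^ n = 1 := fun x hx => by
    exact congrArg Subtype.val (pow_card_eq_one' (x := (⟨x, hx⟩ : H)))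
  let P : Subgroup.center G →* Subgroup.center G :=
    MonoidHom.mk' (· ^ n) fun a b =>
      (show Commute a b from Subtype.ext (Subgroup.mem_center_iff.1 b.2 a)).mul_pow n
  have hsecond : ∀ x ∈ Subgroup.upperCentralSeries G 2,
      x ^ n ∈ Subgroup.upperCentralSeries G 1 := by
    intro x hx
    let φ : G →* Subgroup.center G := P.comp (Subgroup.commutatorHom x hx)
    have hφ : H ≤ φ.ker := by
      intro k hk
      change Subgroup.commutatorHom x hx k ^ n = 1
      rw [← map_pow, hH k hk, map_one]
    rw [Subgroup.mem_upperCentralSeries_succ_iff]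
    intro g
    have hxg : ⁅x, g⁆ ∈ Subgroup.center G := (Subgroup.commutatorHom x hx g).2
    have h1 : ⁅x, g⁆ ^ n = 1 :=
      congrArg Subtype.val (Abelianization.eq_one_of_forall_hom_eq_one htriv
        (QuotientGroup.lift H φ hφ) (QuotientGroup.mk' H g))
    rw [commutatorElement_pow_left_of_commute (Subgroup.mem_center_iff.1 hxg x), h1]
    exact one_mem _
  obtain ⟨c, hc⟩ := Group.IsNilpotent.nilpotent G
  have hpow : ∀ g : G, g ^ n ^ c ∈ Subgroup.center G := by
    intro g
    rw [← Subgroup.upperCentralSeries_one]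
    refine Subgroup.pow_pow_mem_upperCentralSeries_one hsecond c g ?_
    exact Subgroup.upperCentralSeries_mono G c.le_succ (hc ▸ Subgroup.mem_top g)
  have hsup : H ⊔ Subgroup.center G = ⊤ := by
    by_contra hne
    let M := H ⊔ Subgroup.center G
    have : Nontrivial (G ⧸ M) := QuotientGroup.nontrivial_iff.2 hne
    have := Abelianization.nontrivial_of_isNilpotent (G ⧸ M)
    obtain ⟨a, ha⟩ := exists_ne (1 : Abelianization (G ⧸ M))
    obtain ⟨q, rfl⟩ := QuotientGroup.mk_surjective a
    obtain ⟨g, rfl⟩ := QuotientGroup.mk_surjective q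
    obtain ⟨b, hb⟩ := hdiv_pow c (Abelianization.of (g : G ⧸ H))
    obtain ⟨r, rfl⟩ := QuotientGroup.mk_surjective b
    obtain ⟨k, rfl⟩ := QuotientGroup.mk_surjective r
    have h1 := congrArg (Abelianization.map
      (QuotientGroup.map H M (MonoidHom.id G) (le_sup_left : H ≤ M))) hb
    apply ha
    refine h1.symm.trans ?_
    change Abelianization.of (QuotientGroup.mk' M (k ^ n ^ c)) = 1
    rw [show QuotientGroup.mk' M (k ^ n ^ c) = 1 from
      (QuotientGroup.eq_one_iff _).2 ((le_sup_right : _ ≤ M) (hpow k)), map_one]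
  have : Nontrivial (G ⧸ H) := QuotientGroup.nontrivial_iff.2 hproper
  let ψ : Subgroup.center G →* G ⧸ H := (QuotientGroup.mk' H).comp (Subgroup.center G).subtype
  have hψ : Function.Surjective ψ := by
    intro q
    obtain ⟨g, rfl⟩ := QuotientGroup.mk_surjective q
    obtain ⟨h, hh, z, hz, rfl⟩ := Subgroup.mem_sup_of_normal_left.1 (hsup ▸ Subgroup.mem_top g)
    refine ⟨⟨z, hz⟩, ?_⟩
    change (z : G ⧸ H) = ((h * z : G) : G ⧸ H)
    rw [QuotientGroup.mk_mul, (QuotientGroup.eq_one_iff h).2 hh, one_mul]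
  have hker : ψ.ker ≤ P.ker := by
    intro z hz
    exact Subtype.ext (hH z ((QuotientGroup.eq_one_iff (z : G)).1 hz))
  let θ : G ⧸ H →* Subgroup.center G := ψ.liftOfSurjective hψ ⟨P, hker⟩
  have hθ : ∀ z, θ (ψ z) = P z := ψ.liftOfRightInverse_comp_apply _ _ ⟨P, hker⟩
  have hz : ∀ z : Subgroup.center G, z ^ n = 1 := fun z => by
    have h1 := Abelianization.eq_one_of_forall_hom_eq_one htriv θ (ψ z)
    rwa [hθ] at h1
  have := Abelianization.nontrivial_of_isNilpotent (G ⧸ H)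
  obtain ⟨a, ha⟩ := exists_ne (1 : Abelianization (G ⧸ H))
  obtain ⟨b, rfl⟩ := hdiv a
  obtain ⟨q, rfl⟩ := QuotientGroup.mk_surjective b
  obtain ⟨z, rfl⟩ := hψ q
  apply ha
  change Abelianization.of (ψ z) ^ n = 1
  rw [← map_pow, ← map_pow, hz, map_one, map_one]
end

section
/- Let G be a finite group, a₁ : X₁ → G a generalized subgroup of G and a₂ : X₂ → X₁ a generalized subgroup of X₁. Then: (1) if every prime dividing the order of the abelianization (X₂)_ab also divides the order of the abelianization (X₁)_ab, then the composition a₁ ∘ a₂ : X₂ → G is a generalized subgroup of G; and (2) if a₂ is surjective, then the composition a₁ ∘ a₂ : X₂ → G is a generalized subgroup of G. -/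
/-- A nonzero vector over `ZMod p` is detected by an additive homomorphism to `ZMod p`. -/
theorem exists_addMonoidHom_zmod_ne_zero {V : Type*} [AddCommGroup V] {p : ℕ} [Fact p.Prime]
    [Module (ZMod p) V] {v : V} (hv : v ≠ 0) : ∃ ψ : V →+ ZMod p, ψ v ≠ 0 := by
  obtain ⟨ψ, hψ⟩ := Module.Projective.exists_dual_ne_zero (ZMod p) hv
  exact ⟨ψ.toAddMonoidHom, hψ⟩

/-- An abelian group with an element that is not a `p`-th power maps nontrivially onto any
cyclic subgroup of order `p`. -/
theorem exists_monoidHom_ne_one_of_forall_pow_ne {A H : Type*} [CommGroup A] [Group H] {p : ℕ}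
    (hp : p.Prime) {x : A} (hx : ∀ y : A, y ^ p ≠ x) {k : H} (hk : orderOf k = p) :
    ∃ φ : A →* H, φ ≠ 1 ∧ ∀ b, φ b ∈ Subgroup.zpowers k := by
  have : Fact p.Prime := ⟨hp⟩
  let N : AddSubgroup (Additive A) := (nsmulAddMonoidHom (α := Additive A) p).range
  have hxN : (QuotientAddGroup.mk (Additive.ofMul x) : Additive A ⧸ N) ≠ 0 := by
    rw [Ne, QuotientAddGroup.eq_zero_iff]
    rintro ⟨y, hy⟩
    exact hx y.toMul hy
  let := QuotientAddGroup.zmodModule (n := p) (H := N) fun y => ⟨y, rfl⟩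
  obtain ⟨ψ, hψ⟩ := exists_addMonoidHom_zmod_ne_zero (p := p) hxN
  let ι : ZMod p →+ Additive H := ZMod.lift p
    ⟨zmultiplesHom (Additive H) (Additive.ofMul k), by
      rw [zmultiplesHom_apply, natCast_zsmul, ← ofMul_pow, ← hk, pow_orderOf_eq_one, ofMul_one]⟩
  have hι : ∀ n : ℤ, ι n = Additive.ofMul (k ^ n) := fun n => by
    simp [ι, ZMod.lift_coe]
  let φ : A →* H := MonoidHom.toAdditive.symm
    (ι.comp (ψ.comp (QuotientAddGroup.mk' N)))
  have hφ : ∀ b, φ b = (ι (ψ (QuotientAddGroup.mk (Additive.ofMul b)))).toMul := fun _ => rfl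
  refine ⟨φ, fun h => hψ ?_, fun b => ?_⟩
  · have h1 := hφ x
    obtain ⟨n, hn⟩ := ZMod.intCast_surjective (ψ (QuotientAddGroup.mk (Additive.ofMul x)))
    rw [← hn, hι, h] at h1
    rw [← hn, ZMod.intCast_zmod_eq_zero_iff_dvd, ← hk, orderOf_dvd_iff_zpow_eq_one]
    exact h1.symm
  · obtain ⟨n, hn⟩ := ZMod.intCast_surjective (ψ (QuotientAddGroup.mk (Additive.ofMul b)))
    rw [hφ, ← hn, hι]
    exact ⟨n, rfl⟩

/-- A group of bounded exponent in which every element is a `p`-th power has no element of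
order `p`. -/
theorem orderOf_ne_of_forall_exists_pow_eq {A : Type*} [Group A] {p N : ℕ} (hp : p.Prime)
    (hN : N ≠ 0) (hA : ∀ x : A, x ^ N = 1) (hpow : ∀ x : A, ∃ y, y ^ p = x) (b : A) :
    orderOf b ≠ p := by
  intro hb
  obtain ⟨e, m, hm, rfl⟩ := Nat.exists_eq_pow_mul_and_not_dvd hN p hp.ne_one
  have hroot : ∀ j : ℕ, ∃ c : A, c ^ p ^ j = b := by
    intro j
    induction j with
    | zero => exact ⟨b, by simp⟩
    | succ j ih =>
      obtain ⟨c, hc⟩ := ih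
      obtain ⟨d, hd⟩ := hpow c
      exact ⟨d, by rw [pow_succ', pow_mul, hd, hc]⟩
  obtain ⟨c, hc⟩ := hroot e
  exact hm (hb ▸ orderOf_dvd_of_pow_eq_one (by rw [← hc, ← pow_mul, hA]))

section GeneralizedSubgroup

open scoped commutatorElement IsMulCommutative

variable {X G : Type*} [Group X] [Group G] {a : X →* G}

/-- The kernel of a generalized subgroup is central. -/
theorem ker_le_center_of_comp_injective
    (h : Function.Injective fun f : X →* X => a.comp f) : a.ker ≤ Subgroup.center X := by
  intro k hk
  rw [MonoidHom.mem_ker] at hk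
  rw [Subgroup.mem_center_iff]
  intro x
  have hconj : (MulAut.conj k).toMonoidHom = MonoidHom.id X :=
    h (by ext y; simp [hk])
  have hx : k * x * k⁻¹ = x := DFunLike.congr_fun hconj x
  rw [mul_inv_eq_iff_eq_mul] at hx
  exact hx.symm

/-- An endomorphism with values in the kernel of a generalized subgroup is trivial. -/
theorem eq_one_of_comp_injective (h : Function.Injective fun f : X →* X => a.comp f)
    (φ : X →* X) (hφ : ∀ x, φ x ∈ a.ker) : φ = 1 := by
  have hc := fun x => Subgroup.mem_center_iff.1 (ker_le_center_of_comp_injective h (hφ x))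
  let f : X →* X :=
    { toFun := fun x => x * φ x
      map_one' := by simp
      map_mul' := fun x y => by
        rw [map_mul, mul_assoc, ← mul_assoc y, hc x]
        simp only [mul_assoc] }
  have hf : f = MonoidHom.id X := h (by
    ext x
    have := hφ x
    rw [MonoidHom.mem_ker] at this
    simp [f, this])
  ext x
  have hx : x * φ x = x := DFunLike.congr_fun hf x
  simpa using hx

/-- The domain of a generalized subgroup of a finite group has bounded exponent. -/
theorem exists_pow_eq_one_of_comp_injective [Finite G]
    (h : Function.Injective fun f : X →* X => a.comp f) :
    ∃ N : ℕ, N ≠ 0 ∧ ∀ x : X, x ^ N = 1 := by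
  have : (Subgroup.center X).FiniteIndex :=
    Subgroup.finiteIndex_of_le (ker_le_center_of_comp_injective h)
  let φ : X →* X := (Subgroup.center X).subtype.comp
    ((powMonoidHom (Nat.card G)).comp (MonoidHom.transferCenterPow X))
  have hφ : ∀ x, φ x = (x ^ (Subgroup.center X).index) ^ Nat.card G := fun x => by
    simp [φ, MonoidHom.transferCenterPow_apply]
  refine ⟨(Subgroup.center X).index * Nat.card G,
    mul_ne_zero Subgroup.FiniteIndex.index_ne_zero Nat.card_pos.ne', fun x => ?_⟩
  rw [pow_mul, ← hφ, eq_one_of_comp_injective h φ fun y => by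
    rw [MonoidHom.mem_ker, hφ, map_pow, pow_card_eq_one'], MonoidHom.one_apply]

/-- The kernel and the abelianization of the domain of a generalized subgroup of a finite group
have no common torsion primes. -/
theorem not_dvd_orderOf_of_comp_injective [Finite G]
    (h : Function.Injective fun f : X →* X => a.comp f) {p : ℕ} (hp : p.Prime) {k : X}
    (hk : k ∈ a.ker) {b : Abelianization X} (hb : orderOf b = p) : ¬ p ∣ orderOf k := by
  intro hpk
  obtain ⟨N, hN, hX⟩ := exists_pow_eq_one_of_comp_injective h
  have hk0 : orderOf k ≠ 0 := fun h0 =>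
    hN (Nat.eq_zero_of_zero_dvd (h0 ▸ orderOf_dvd_of_pow_eq_one (hX k)))
  have hk' : orderOf (k ^ (orderOf k / p)) = p := orderOf_pow_orderOf_div hk0 hpk
  refine orderOf_ne_of_forall_exists_pow_eq (A := Abelianization X) hp hN ?_ ?_ b hb
  · intro x
    obtain ⟨x, rfl⟩ := QuotientGroup.mk_surjective x
    exact (map_pow Abelianization.of x N).symm.trans (by rw [hX, map_one])
  · by_contra! hx
    obtain ⟨x, hx⟩ := hx
    obtain ⟨φ, hφ, hφk⟩ := exists_monoidHom_ne_one_of_forall_pow_ne hp hx hk'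
    have h1 := eq_one_of_comp_injective h (φ.comp Abelianization.of) fun x =>
      (Subgroup.zpowers_le.2 (pow_mem hk _)) (hφk _)
    exact hφ (Abelianization.hom_ext _ _ h1)

/-- The kernel of a generalized subgroup of a finite group lies in the commutator subgroup. -/
theorem ker_le_commutator_of_comp_injective [Finite G]
    (h : Function.Injective fun f : X →* X => a.comp f) : a.ker ≤ commutator X := by
  intro k hk
  rw [← Abelianization.ker_of, MonoidHom.mem_ker]
  by_contra hne
  have hp := Nat.minFac_prime (mt orderOf_eq_one_iff.1 hne)
  obtain ⟨N, hN, hX⟩ := exists_pow_eq_one_of_comp_injective h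
  have hk0 : orderOf (Abelianization.of k) ≠ 0 := fun h0 =>
    hN (Nat.eq_zero_of_zero_dvd
      (h0 ▸ orderOf_dvd_of_pow_eq_one (by rw [← map_pow, hX, map_one])))
  exact not_dvd_orderOf_of_comp_injective h hp hk
    (orderOf_pow_orderOf_div hk0 (Nat.minFac_dvd _))
    ((Nat.minFac_dvd _).trans (orderOf_map_dvd _ k))

/-- A generalized subgroup of a finite group has finite domain. -/
theorem finite_of_comp_injective [Finite G]
    (h : Function.Injective fun f : X →* X => a.comp f) : Finite X := by
  have hcomm : ∀ x y x' y' : X, a x = a x' → a y = a y' → ⁅x, y⁆ = ⁅x', y'⁆ := by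
    intro x y x' y' hx hy
    have hmem : ∀ {u v : X}, a u = a v → v⁻¹ * u ∈ Subgroup.center X := fun huv =>
      ker_le_center_of_comp_injective h (by simp [MonoidHom.mem_ker, huv])
    obtain ⟨c, hc⟩ : ∃ c, c = x'⁻¹ * x := ⟨_, rfl⟩
    obtain ⟨d, hd⟩ : ∃ d, d = y'⁻¹ * y := ⟨_, rfl⟩
    have hcc := Subgroup.mem_center_iff.1 (hc ▸ hmem hx)
    have hdc := Subgroup.mem_center_iff.1 (hd ▸ hmem hy)
    obtain rfl : x = x' * c := by rw [hc]; group
    obtain rfl : y = y' * d := by rw [hd]; group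
    have h1 : x' * c * (y' * d) = x' * y' * (c * d) := by
      rw [mul_assoc, ← mul_assoc c, ← hcc y']; simp only [mul_assoc]
    have h2 : y' * d * (x' * c) = y' * x' * (c * d) := by
      rw [mul_assoc, ← mul_assoc d, ← hdc x', hcc d |>.symm]; simp only [mul_assoc]
    have h3 : ∀ u v : X, ⁅u, v⁆ = u * v * (v * u)⁻¹ := fun u v => by
      rw [commutatorElement_def]; group
    rw [h3, h3, h1, h2]; group
  have : Finite (commutatorSet X) := by
    have hfin : (Set.range fun q : a.range × a.range =>
        ⁅q.1.2.choose, q.2.2.choose⁆).Finite := Set.finite_range _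
    refine (hfin.subset ?_).to_subtype
    rintro _ ⟨x, y, rfl⟩
    exact ⟨(⟨a x, x, rfl⟩, ⟨a y, y, rfl⟩),
      hcomm _ _ _ _ (Exists.choose_spec (⟨x, rfl⟩ : ∃ z, a z = a x))
        (Exists.choose_spec (⟨y, rfl⟩ : ∃ z, a z = a y))⟩
  have : Finite a.ker :=
    Finite.of_injective _ (Subgroup.inclusion_injective (ker_le_commutator_of_comp_injective h))
  have : Finite (X ⧸ a.ker) := Finite.of_injective _ (QuotientGroup.kerLift_injective a)
  exact Finite.of_subgroup_quotient a.ker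

/-- A generalized subgroup of a generalized subgroup `X` of a finite group is again one if the
torsion primes of its abelianization divide the order of the abelianization of `X`. -/
theorem comp_injective_of_prime_dvd_card_abelianization [Finite G] {Y : Type*} [Group Y]
    {b : Y →* X} (ha : Function.Injective fun f : X →* X => a.comp f)
    (hb : Function.Injective fun f : Y →* Y => b.comp f)
    (hdvd : ∀ p : ℕ, p.Prime → p ∣ Nat.card (Abelianization Y) →
      p ∣ Nat.card (Abelianization X)) :
    Function.Injective fun f : Y →* Y => (a.comp b).comp f := by
  intro f g hfg
  apply hb
  have hker : ∀ y, b (f y) * (b (g y))⁻¹ ∈ a.ker := fun y => by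
    have hy : a (b (f y)) = a (b (g y)) := DFunLike.congr_fun hfg y
    rw [MonoidHom.mem_ker, map_mul, map_inv, hy, mul_inv_cancel]
  have hcen := fun y => ker_le_center_of_comp_injective ha (hker y)
  let φ : Y →* Subgroup.center X :=
    { toFun := fun y => ⟨b (f y) * (b (g y))⁻¹, hcen y⟩
      map_one' := by ext; simp
      map_mul' := fun x y => by
        ext
        have hy := Subgroup.mem_center_iff.1 (hcen y) (b (g x))⁻¹
        simp only [map_mul, mul_inv_rev, Subgroup.coe_mul, mul_assoc] at hy ⊢
        rw [hy] }
  have := finite_of_comp_injective ha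
  by_contra hne
  obtain ⟨y, hy⟩ : ∃ y, b (f y) * (b (g y))⁻¹ ≠ 1 := by
    by_contra! hall
    exact hne (MonoidHom.ext fun y => mul_inv_eq_one.1 (hall y))
  have hp := Nat.minFac_prime (mt orderOf_eq_one_iff.1 hy)
  have hpk := Nat.minFac_dvd (orderOf (b (f y) * (b (g y))⁻¹))
  have hpY := calc
    orderOf (b (f y) * (b (g y))⁻¹) = orderOf (φ y) := (Subgroup.orderOf_coe (φ y))
    _ = orderOf (Abelianization.lift φ (Abelianization.of y)) := by
      rw [Abelianization.lift_apply_of]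
    _ ∣ orderOf (Abelianization.of y) := orderOf_map_dvd _ _
    _ ∣ Nat.card (Abelianization Y) := orderOf_dvd_natCard _
  have := Fact.mk hp
  obtain ⟨z, hz⟩ := exists_prime_orderOf_dvd_card' _ (hdvd _ hp (hpk.trans hpY))
  exact not_dvd_orderOf_of_comp_injective ha hp (hker y) hz hpk

/-- A surjective generalized subgroup of a finite group induces an injection of
abelianizations. -/
theorem abelianization_map_injective_of_comp_injective [Finite G]
    (h : Function.Injective fun f : X →* X => a.comp f) (hsurj : Function.Surjective a) :
    Function.Injective (Abelianization.map a) := by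
  rw [injective_iff_map_eq_one]
  intro z hz
  obtain ⟨x, rfl⟩ := QuotientGroup.mk_surjective z
  change Abelianization.of x = 1
  replace hz : Abelianization.of (a x) = 1 := hz
  rw [← MonoidHom.mem_ker, Abelianization.ker_of] at hz ⊢
  have hmap : (commutator X).map a = commutator G := by
    rw [commutator_def, commutator_def, Subgroup.map_commutator, ← MonoidHom.range_eq_map,
      MonoidHom.range_eq_top.2 hsurj]
  rw [← hmap] at hz
  obtain ⟨c, hc, hcx⟩ := hz
  have hk := ker_le_commutator_of_comp_injective h (x := c⁻¹ * x)
    (by rw [MonoidHom.mem_ker, map_mul, map_inv, hcx, inv_mul_cancel])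
  simpa using mul_mem hc hk

end GeneralizedSubgroup


/-- Let `G` be finite, `a₁ : X₁ → G` a generalized subgroup of `G`
and `a₂ : X₂ → X₁` a generalized subgroup of `X₁`. Then (1) if every prime dividing
the order of `(X₂)_ab` also divides the order of `(X₁)_ab`, the composition
`a₁ ∘ a₂ : X₂ → G` is a generalized subgroup of `G`; and (2) if `a₂` is surjective,
then `a₁ ∘ a₂` is a generalized subgroup of `G`. -/
theorem stmt16 {G X₁ X₂ : Type*} [Group G] [Group X₁] [Group X₂] [Finite G]
    (a₁ : X₁ →* G) (a₂ : X₂ →* X₁)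
    (h₁ : Function.Injective (fun f : X₁ →* X₁ => a₁.comp f))
    (h₂ : Function.Injective (fun f : X₂ →* X₂ => a₂.comp f)) :
    ((∀ p : ℕ, p.Prime → p ∣ Nat.card (Abelianization X₂) →
        p ∣ Nat.card (Abelianization X₁)) →
      Function.Injective (fun f : X₂ →* X₂ => (a₁.comp a₂).comp f)) ∧
    (Function.Surjective a₂ →
      Function.Injective (fun f : X₂ →* X₂ => (a₁.comp a₂).comp f)) := by
  have key := comp_injective_of_prime_dvd_card_abelianization h₁ h₂
  have := finite_of_comp_injective h₁
  exact ⟨key, fun hsurj => key fun p _ hp => hp.trans <| Subgroup.card_dvd_of_injective _ <|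
    abelianization_map_injective_of_comp_injective h₂ hsurj⟩
end
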